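/- arXiv:2407.02339 — 3 statements merged into one kernel-verified Lean document; each statement's English description precedes it below -/
import Mathlib

section
/- For every finite nonempty index set J, every function V : J → ℝ, and every i ∈ J, the integral over ℝ of the function x ↦ exp(V i − x) · exp(−∑_{j ∈ J} exp(V j − x)) equals exp(V i) / ∑_{j ∈ J} exp(V j). -/
open MeasureTheory Real

/-- Closed-form evaluation of the multinomial-logit choice probability integral:
for a finite nonempty index set `J`, deterministic utilities `V : J → ℝ` and any `i ∈ J`,
`∫ x, exp (V i - x) * exp (-∑ j, exp (V j - x)) = exp (V i) / ∑ j, exp (V j)`. -/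
theorem logit_integral {J : Type*} [Fintype J] [Nonempty J] (V : J → ℝ) (i : J) :
    (∫ x : ℝ, Real.exp (V i - x) * Real.exp (-∑ j : J, Real.exp (V j - x))) =
      Real.exp (V i) / ∑ j : J, Real.exp (V j) := by
  have hS : 0 < ∑ j : J, Real.exp (V j) :=
    Finset.sum_pos (fun j _ => Real.exp_pos _) Finset.univ_nonempty
  have hsum : ∀ x : ℝ, ∑ j : J, Real.exp (V j - x) = (∑ j : J, Real.exp (V j)) * Real.exp (-x) := by
    intro x
    rw [Finset.sum_mul]
    exact Finset.sum_congr rfl fun j _ => by rw [← Real.exp_add, sub_eq_add_neg]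
  simp only [hsum]
  generalize (∑ j : J, Real.exp (V j)) = S at hS
  set f : ℝ → ℝ := fun x => Real.exp (V i - x) * Real.exp (-(S * Real.exp (-x))) with hf
  set F : ℝ → ℝ := fun x => Real.exp (V i) / S * Real.exp (-(S * Real.exp (-x))) with hF
  have hderiv : ∀ x, HasDerivAt F (f x) x := by
    intro x
    have h := (((hasDerivAt_neg x).exp.const_mul S).neg.exp).const_mul (Real.exp (V i) / S)
    refine h.congr_deriv ?_
    simp only [hf, sub_eq_add_neg, Real.exp_add]
    field_simp
    rfl
  have hcont : Continuous f := by fun_prop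
  have hbot : Filter.Tendsto F Filter.atBot (nhds 0) := by
    have h1 : Filter.Tendsto (fun x : ℝ => -(S * Real.exp (-x))) Filter.atBot Filter.atBot :=
      Filter.tendsto_neg_atTop_atBot.comp
        ((Real.tendsto_exp_atTop.comp Filter.tendsto_neg_atBot_atTop).const_mul_atTop hS)
    simpa using (Real.tendsto_exp_atBot.comp h1).const_mul (Real.exp (V i) / S)
  have htop : Filter.Tendsto F Filter.atTop (nhds (Real.exp (V i) / S)) := by
    have h1 : Filter.Tendsto (fun x : ℝ => -(S * Real.exp (-x))) Filter.atTop (nhds 0) := by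
      simpa using
        ((Real.tendsto_exp_atBot.comp Filter.tendsto_neg_atTop_atBot).const_mul S).neg
    simpa using ((Real.continuous_exp.tendsto 0).comp h1).const_mul (Real.exp (V i) / S)
  have hint : Integrable f := by
    refine integrable_of_intervalIntegral_norm_tendsto (l := Filter.atTop)
      (a := fun x : ℝ => -x) (b := fun x : ℝ => x) (Real.exp (V i) / S - 0)
      (fun x => hcont.integrableOn_Ioc) Filter.tendsto_neg_atTop_atBot Filter.tendsto_id ?_
    have hn : ∀ x, ‖f x‖ = f x := fun x => Real.norm_of_nonneg (by positivity)
    simp only [hn]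
    have he : ∀ x : ℝ, ∫ y in (-x)..x, f y = F x - F (-x) := fun x =>
      intervalIntegral.integral_eq_sub_of_hasDerivAt (fun y _ => hderiv y)
        (hcont.intervalIntegrable _ _)
    simp only [he]
    exact htop.sub (hbot.comp Filter.tendsto_neg_atTop_atBot)
  rw [integral_of_hasDerivAt_of_tendsto hderiv hint hbot htop, sub_zero]
end

section
/- Let X be a pseudometric space and let S ⊆ T be finite nonempty subsets of X. Define the optimal tour cost of a finite nonempty set A ⊆ X as the minimum, over all lists enumerating the elements of A exactly once, of the closed tour length of that list. Then the optimal tour cost of S is at most the optimal tour cost of T. -/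
/-- The closed tour length of a list of points in a pseudometric space: the sum of the
distances between consecutive points, plus the return distance from the last point back
to the first (obtained by pairing the list with its rotation by one). -/
noncomputable def listClosedTour {X : Type*} [PseudoMetricSpace X] (l : List X) : ℝ :=
  (List.zipWith dist l (l.rotate 1)).sum

/-- The optimal tour cost of a finite set `A` of points: the minimum, over all lists
enumerating the elements of `A` exactly once, of the closed tour length of that list. -/
noncomputable def optTourCost {X : Type*} [PseudoMetricSpace X] (A : Finset X) : ℝ :=
  sInf (listClosedTour '' {l : List X | l.Perm A.toList})

/-- Length of the open path from `a` through the list to `b`. -/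
noncomputable def pathLen {X : Type*} [PseudoMetricSpace X] : X → List X → X → ℝ
  | a, [], b => dist a b
  | a, c :: l, b => dist a c + pathLen c l b

theorem zip_eq_pathLen {X : Type*} [PseudoMetricSpace X] (l : List X) (a b : X) :
    (List.zipWith dist (a :: l) (l ++ [b])).sum = pathLen a l b := by
  induction l generalizing a with
  | nil => simp [pathLen]
  | cons c l ih =>
    have := ih c
    simp only [List.cons_append, List.zipWith_cons_cons, List.sum_cons, pathLen] at this ⊢
    rw [this]

theorem tour_cons {X : Type*} [PseudoMetricSpace X] (l : List X) (a : X) :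
    listClosedTour (a :: l) = pathLen a l a := by
  rw [← zip_eq_pathLen]
  simp [listClosedTour]

theorem pathLen_left {X : Type*} [PseudoMetricSpace X] (l : List X) (a c b : X) :
    pathLen a l b ≤ dist a c + pathLen c l b := by
  cases l with
  | nil => exact dist_triangle a c b
  | cons d l =>
    simp only [pathLen]
    linarith [dist_triangle a c d]

theorem pathLen_right {X : Type*} [PseudoMetricSpace X] (l : List X) (a b c : X) :
    pathLen a l c ≤ pathLen a l b + dist b c := by
  induction l generalizing a with
  | nil => exact dist_triangle a b c
  | cons d l ih =>
    simp only [pathLen]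
    linarith [ih d]

theorem pathLen_sublist {X : Type*} [PseudoMetricSpace X] {l m : List X} (h : l.Sublist m)
    (a b : X) : pathLen a l b ≤ pathLen a m b := by
  induction h generalizing a with
  | slnil => exact le_rfl
  | cons c _ ih => exact (ih a).trans (pathLen_left _ a c b)
  | cons_cons c _ ih =>
    simp only [pathLen]
    linarith [ih c]

theorem tour_nonneg {X : Type*} [PseudoMetricSpace X] (l : List X) : 0 ≤ listClosedTour l := by
  cases l with
  | nil => simp [listClosedTour]
  | cons a l =>
    rw [tour_cons]
    have h := pathLen_sublist (List.nil_sublist l) a a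
    simpa [pathLen] using h

theorem tour_sublist {X : Type*} [PseudoMetricSpace X] {l m : List X} (h : l.Sublist m) :
    listClosedTour l ≤ listClosedTour m := by
  induction h with
  | slnil => exact le_rfl
  | @cons l m c _ ih =>
    refine ih.trans ?_
    cases m with
    | nil => simpa [listClosedTour] using tour_nonneg [c]
    | cons d m =>
      rw [tour_cons, tour_cons]
      simp only [pathLen]
      linarith [pathLen_right m d c d]
  | cons_cons c h _ =>
    rw [tour_cons, tour_cons]
    exact pathLen_sublist h c c

/-- Monotonicity of the optimal tour cost: if `S ⊆ T` are finite nonempty sets of points,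
then the optimal tour cost of `S` is at most the optimal tour cost of `T`. -/
theorem optTourCost_mono {X : Type*} [PseudoMetricSpace X] (S T : Finset X)
    (hS : S.Nonempty) (hST : S ⊆ T) :
    optTourCost S ≤ optTourCost T := by
  classical
  unfold optTourCost
  apply le_csInf
  · exact ⟨_, T.toList, List.Perm.refl _, rfl⟩
  · rintro _ ⟨l, hl, rfl⟩
    have hl : l.Perm T.toList := hl
    refine le_trans (csInf_le ?_ ⟨l.filter (· ∈ S), ?_, rfl⟩) (tour_sublist List.filter_sublist)
    · refine ⟨0, ?_⟩
      rintro _ ⟨m, _, rfl⟩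
      exact tour_nonneg m
    · have hn : l.Nodup := hl.nodup_iff.mpr T.nodup_toList
      refine (List.perm_ext_iff_of_nodup (hn.filter _) S.nodup_toList).mpr ?_
      intro x
      simp only [List.mem_filter, hl.mem_iff, Finset.mem_toList, decide_eq_true_eq]
      exact ⟨fun h => h.2, fun h => ⟨hST h, h⟩⟩
end

section
/- Let X be a pseudometric space, let x₀, …, x_k (k ≥ 0) be points of X, and let v ∈ X. Then there exists an insertion position p with 0 ≤ p ≤ k such that the closed tour length of the sequence obtained by inserting v immediately after x_p is at most the closed tour length of x₀, …, x_k plus 2·min_{0 ≤ j ≤ k} d(v, x_j). In particular it is at most the original closed tour length plus 2·max_{0 ≤ j ≤ k} d(v, x_j). -/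
/-- The closed tour length of the sequence `x 0, …, x n` in a pseudometric space:
`∑_{i=0}^{n} d(x i, x ((i+1) mod (n+1)))` (indices in `Fin (n+1)` wrap around). -/
noncomputable def closedTour {X : Type*} [PseudoMetricSpace X] {n : ℕ}
    (x : Fin (n + 1) → X) : ℝ :=
  ∑ i : Fin (n + 1), dist (x i) (x (i + 1))

theorem succAbove_aux1 {k : ℕ} (p : Fin (k + 1)) :
    p.succ + 1 = p.succ.succAbove (p + 1) := by
  ext
  have := p.isLt
  simp only [Fin.succAbove, Fin.val_add_one, Fin.lt_def, Fin.val_castSucc, Fin.val_succ,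
    Fin.ext_iff, Fin.val_last]
  split_ifs <;> simp_all [Fin.val_add_one, Fin.ext_iff]

theorem succAbove_aux2 {k : ℕ} (p : Fin (k + 1)) :
    p.succ.succAbove p + 1 = p.succ := by
  rw [Fin.succAbove_of_castSucc_lt _ _ Fin.castSucc_lt_succ]
  exact Fin.coeSucc_eq_succ

theorem succAbove_aux3 {k : ℕ} (p i : Fin (k + 1)) (h : i ≠ p) :
    p.succ.succAbove i + 1 = p.succ.succAbove (i + 1) := by
  have hp := p.isLt
  have hi := i.isLt
  have h' : i.val ≠ p.val := fun e => h (Fin.ext e)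
  ext
  rw [Fin.val_add_one]
  simp only [Fin.succAbove, Fin.lt_def, Fin.val_castSucc, Fin.val_succ,
    Fin.ext_iff, Fin.val_last, Fin.val_add_one, apply_ite Fin.val]
  split_ifs <;> omega

theorem closedTour_insert_eq {X : Type*} [PseudoMetricSpace X] {k : ℕ}
    (x : Fin (k + 1) → X) (v : X) (p : Fin (k + 1)) :
    closedTour (Fin.insertNth p.succ v x : Fin (k + 1 + 1) → X) =
      closedTour x + (dist (x p) v + dist v (x (p + 1)) - dist (x p) (x (p + 1))) := by
  unfold closedTour
  rw [Fin.sum_univ_succAbove _ p.succ, succAbove_aux1]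
  simp only [Fin.insertNth_apply_same, Fin.insertNth_apply_succAbove]
  rw [← Finset.add_sum_erase Finset.univ _ (Finset.mem_univ p), succAbove_aux2,
    ← Finset.add_sum_erase Finset.univ (fun i => dist (x i) (x (i + 1))) (Finset.mem_univ p)]
  have : ∀ i ∈ Finset.univ.erase p,
      dist (x i) ((Fin.insertNth p.succ v x : Fin (k + 1 + 1) → X) (p.succ.succAbove i + 1)) =
        dist (x i) (x (i + 1)) := by
    intro i hi
    rw [succAbove_aux3 p i (Finset.ne_of_mem_erase hi), Fin.insertNth_apply_succAbove]
  rw [Finset.sum_congr rfl this]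
  simp only [Fin.insertNth_apply_same]
  ring

/-- Cheapest insertion: a new point `v` can be inserted immediately after some point `x p`
of a closed tour at an extra cost of at most `2 * min_j d(v, x j)`, and in particular at
most `2 * max_j d(v, x j)`. -/
theorem closedTour_insert_le {X : Type*} [PseudoMetricSpace X] {k : ℕ}
    (x : Fin (k + 1) → X) (v : X) :
    ∃ p : Fin (k + 1),
      closedTour (Fin.insertNth p.succ v x) ≤
        closedTour x
          + 2 * Finset.univ.inf' Finset.univ_nonempty (fun j => dist v (x j)) ∧
      closedTour (Fin.insertNth p.succ v x) ≤
        closedTour x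
          + 2 * Finset.univ.sup' Finset.univ_nonempty (fun j => dist v (x j)) := by
  obtain ⟨p, -, hp⟩ := Finset.exists_mem_eq_inf' (Finset.univ_nonempty (α := Fin (k + 1)))
    (fun j => dist v (x j))
  have hs := Finset.le_sup' (fun j => dist v (x j)) (Finset.mem_univ p)
  have ht := dist_triangle v (x p) (x (p + 1))
  have hc := dist_comm v (x p)
  refine ⟨p, ?_, ?_⟩
  · rw [closedTour_insert_eq, hp]
    linarith
  · rw [closedTour_insert_eq]
    linarith
end
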